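/- Let n₁,…,n_ℓ be natural numbers and write n₁⋯n_ℓ = r·s where r and s are coprime, r is squarefree, and s is squarefull (every prime dividing s divides it at least twice). Then |B(n₁,…,n_ℓ)| ≤ 2^{−ℓ} r^{−1}. -/

import Mathlib

open scoped Classical Real
open Complex MeasureTheory

/-- The sawtooth function `ψ`. -/
noncomputable def saw (x : ℝ) : ℝ := if Int.fract x = 0 then 0 else Int.fract x - 1/2

/-- The correlation `B(n₁, …, n_ℓ)` of sawtooth functions. -/
noncomputable def Bcorr {l : ℕ} (n : Fin l → ℕ) : ℝ :=
  (1 / ∏ j, (n j : ℝ)) * ∫ x in (0 : ℝ)..(∏ j, (n j : ℝ)), ∏ j, saw (x / n j)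

theorem saw_eq (x : ℝ) : saw x = Int.fract x - 1 / 2 + if Int.fract x = 0 then 1 / 2 else 0 := by
  unfold saw
  split_ifs with h
  · rw [h]; norm_num
  · ring

theorem abs_saw_le (x : ℝ) : |saw x| ≤ 1 / 2 := by
  unfold saw
  split_ifs with h
  · norm_num
  · rw [abs_le]
    constructor <;> linarith [Int.fract_nonneg x, Int.fract_lt_one x]

theorem measurable_saw : Measurable saw :=
  Measurable.ite (measurable_fract (measurableSet_singleton 0)) measurable_const
    (measurable_fract.sub_const _)

theorem saw_add_int (x : ℝ) (m : ℤ) : saw (x + m) = saw x := by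
  simp [saw]

theorem abs_prod_saw_le {l : ℕ} (n : Fin l → ℕ) (x : ℝ) :
    |∏ j, saw (x / n j)| ≤ ((2 : ℝ) ^ l)⁻¹ := by
  rw [Finset.abs_prod]
  calc ∏ j, |saw (x / n j)| ≤ ∏ _j : Fin l, (1 / 2 : ℝ) :=
        Finset.prod_le_prod (fun _ _ => abs_nonneg _) fun _ _ => abs_saw_le _
    _ = ((2 : ℝ) ^ l)⁻¹ := by simp

theorem intervalIntegrable_prod_saw {l : ℕ} (n : Fin l → ℕ) (c a b : ℝ) :
    IntervalIntegrable (fun x : ℝ => ∏ j, saw ((x + c) / n j)) volume a b := by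
  have hm : Measurable fun x : ℝ => ∏ j, saw ((x + c) / n j) :=
    Finset.measurable_prod _ fun j _ =>
      measurable_saw.comp ((measurable_id.add_const c).div_const _)
  refine (intervalIntegrable_const (c := ((2 : ℝ) ^ l)⁻¹)).mono_fun hm.aestronglyMeasurable ?_
  refine Filter.Eventually.of_forall fun x => ?_
  simp only [Real.norm_eq_abs]
  exact (abs_prod_saw_le n (x + c)).trans (le_abs_self _)

theorem abs_Bcorr_le {l : ℕ} (n : Fin l → ℕ) : |Bcorr n| ≤ ((2 : ℝ) ^ l)⁻¹ := by
  have hN : (0 : ℝ) ≤ ∏ j, (n j : ℝ) := Finset.prod_nonneg fun _ _ => Nat.cast_nonneg _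
  have h := intervalIntegral.norm_integral_le_of_norm_le_const (a := 0) (b := ∏ j, (n j : ℝ))
    (f := fun x : ℝ => ∏ j, saw (x / n j)) (C := ((2 : ℝ) ^ l)⁻¹)
    fun x _ => abs_prod_saw_le n x
  rw [Real.norm_eq_abs, sub_zero, abs_of_nonneg hN] at h
  unfold Bcorr
  rw [abs_mul, abs_of_nonneg (one_div_nonneg.2 hN)]
  rcases hN.eq_or_lt with h0 | h0
  · rw [← h0]; simp
  · rw [one_div, inv_mul_le_iff₀ h0, mul_comm]
    exact h

theorem fract_natCast_add_div {p r : ℕ} (hr : r < p) {t : ℝ} (ht : 0 ≤ t) (ht' : t < 1) :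
    Int.fract ((r + t) / p : ℝ) = (r + t) / p := by
  have hp : (0 : ℝ) < p := by exact_mod_cast (Nat.zero_le r).trans_lt hr
  have hr' : (r : ℝ) + 1 ≤ p := by exact_mod_cast hr
  rw [Int.fract_eq_self]
  exact ⟨by positivity, by rw [div_lt_one hp]; linarith⟩

theorem sum_range_saw_add_div {p : ℕ} (hp : 0 < p) {t : ℝ} (ht : 0 ≤ t) (ht' : t < 1) :
    ∑ r ∈ Finset.range p, saw ((r + t) / p) = saw t := by
  have hp' : (0 : ℝ) < p := by exact_mod_cast hp
  have hterm : ∀ r ∈ Finset.range p, saw ((r + t) / p) =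
      ((r : ℝ) / p + t / p - 1 / 2) + if r = 0 then (if t = 0 then 1 / 2 else 0) else 0 := by
    intro r hr
    rw [saw_eq, fract_natCast_add_div (Finset.mem_range.1 hr) ht ht', add_div]
    congr 1
    simp only [← add_div, div_eq_zero_iff, hp.ne', or_false,
      add_eq_zero_iff_of_nonneg (Nat.cast_nonneg r) ht, Nat.cast_eq_zero, ite_and]
  have hsum : ∑ r ∈ Finset.range p, (r : ℝ) = p * (p - 1) / 2 := by
    have h := Finset.sum_range_id_mul_two p
    have h2 : (∑ r ∈ Finset.range p, (r : ℝ)) * 2 = p * (p - 1) := by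
      rw [← Nat.cast_pred hp, ← Nat.cast_sum]
      exact_mod_cast h
    linarith
  rw [Finset.sum_congr rfl hterm, Finset.sum_add_distrib, Finset.sum_ite_eq',
    if_pos (Finset.mem_range.2 hp), Finset.sum_sub_distrib, Finset.sum_add_distrib,
    ← Finset.sum_div, hsum, saw_eq, Int.fract_eq_self.2 ⟨ht, ht'⟩]
  simp only [Finset.sum_const, Finset.card_range, nsmul_eq_mul]
  field_simp
  ring

theorem sum_range_natCast_zmod {p : ℕ} [NeZero p] (f : ZMod p → ℝ) :
    ∑ k ∈ Finset.range p, f k = ∑ z, f z := by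
  refine Finset.sum_bij' (fun k _ => (k : ZMod p)) (fun z _ => z.val) ?_ ?_ ?_ ?_ ?_
  · simp
  · intro z _
    simpa using ZMod.val_lt z
  · intro k hk
    exact ZMod.val_cast_of_lt (Finset.mem_range.1 hk)
  · simp
  · simp

/-- The distribution relation for the sawtooth function, along multiples of a unit modulo `p`. -/
theorem sum_range_saw_add_mul_div {p a : ℕ} (hp : 0 < p) (ha : Nat.Coprime a p) (x : ℝ) :
    ∑ k ∈ Finset.range p, saw (x + (k * a : ℝ) / p) = saw (p * x) := by
  have hp' : (p : ℝ) ≠ 0 := by exact_mod_cast hp.ne'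
  have : NeZero p := ⟨hp.ne'⟩
  set m : ℤ := ⌊(p : ℝ) * x⌋ with hm
  set t : ℝ := Int.fract ((p : ℝ) * x) with ht
  have hx : (p : ℝ) * x = m + t := (Int.floor_add_fract _).symm
  have hterm : ∀ k : ℕ, saw (x + (k * a : ℝ) / p) =
      saw ((((m : ZMod p) + (k : ZMod p) * a).val + t) / p) := by
    intro k
    have hv : ((((m : ZMod p) + (k : ZMod p) * a).val : ℕ) : ℤ) = (m + k * a) % p := by
      rw [← ZMod.val_intCast]
      push_cast
      rfl
    have hd := Int.emod_add_mul_ediv (m + k * a) p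
    rw [← hv] at hd
    rw [← saw_add_int ((((m : ZMod p) + (k : ZMod p) * a).val + t) / p) ((m + k * a) / p)]
    congr 1
    have hd' := congrArg (Int.cast : ℤ → ℝ) hd
    simp only [Int.cast_add, Int.cast_mul, Int.cast_natCast] at hd'
    field_simp
    linarith
  let u : (ZMod p)ˣ := ZMod.unitOfCoprime a ha
  calc ∑ k ∈ Finset.range p, saw (x + (k * a : ℝ) / p)
      = ∑ z : ZMod p, saw ((((m : ZMod p) + z * a).val + t) / p) := by
        rw [Finset.sum_congr rfl fun k _ => hterm k]
        exact sum_range_natCast_zmod fun z : ZMod p => saw ((((m : ZMod p) + z * a).val + t) / p)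
    _ = ∑ z : ZMod p, saw ((z.val + t) / p) :=
        (u.mulRight.trans (Equiv.addLeft (m : ZMod p))).sum_comp
          fun z : ZMod p => saw ((z.val + t) / p)
    _ = ∑ r ∈ Finset.range p, saw ((r + t) / p) := by
        rw [← sum_range_natCast_zmod fun z : ZMod p => saw ((z.val + t) / p)]
        refine Finset.sum_congr rfl fun k hk => ?_
        rw [ZMod.val_cast_of_lt (Finset.mem_range.1 hk)]
    _ = saw t := sum_range_saw_add_div hp (Int.fract_nonneg _) (Int.fract_lt_one _)
    _ = saw (p * x) := by rw [hx, add_comm, saw_add_int]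

/-- A factor `p` of one modulus that is coprime to all the other ones can be split off. -/
theorem Bcorr_eq_inv_mul_Bcorr_update {l : ℕ} (n : Fin l → ℕ) (hn : ∀ j, 0 < n j) (j : Fin l)
    {p m : ℕ} (hp : 0 < p) (hm : n j = p * m)
    (hco : Nat.Coprime (∏ i ∈ Finset.univ.erase j, n i) p) :
    Bcorr n = (p : ℝ)⁻¹ * Bcorr (Function.update n j m) := by
  set A : ℕ := ∏ i ∈ Finset.univ.erase j, n i with hA
  have hm0 : 0 < m := Nat.pos_of_mul_pos_left (hm ▸ hn j)
  have hp' : (p : ℝ) ≠ 0 := by exact_mod_cast hp.ne'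
  have hm' : (m : ℝ) ≠ 0 := by exact_mod_cast hm0.ne'
  have hprod : ∀ f : Fin l → ℝ, ∏ i, f i = f j * ∏ i ∈ Finset.univ.erase j, f i := fun f =>
    (Finset.mul_prod_erase _ f (Finset.mem_univ j)).symm
  have hne : ∀ i ∈ Finset.univ.erase j, Function.update n j m i = n i := fun i hi =>
    Function.update_of_ne (Finset.ne_of_mem_erase hi) _ _
  set Q : ℝ := m * A with hQ
  have hN : ∏ i, (n i : ℝ) = p * Q := by
    rw [hprod, hm, hQ, hA]
    push_cast
    ring
  have hN' : ∏ i, (Function.update n j m i : ℝ) = Q := by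
    rw [hprod, Function.update_self, hQ, hA, Nat.cast_prod]
    congr 1
    exact Finset.prod_congr rfl fun i hi => by rw [hne i hi]
  have hpt : ∀ x : ℝ, ∑ k ∈ Finset.range p, ∏ i, saw ((x + k * Q) / n i) =
      ∏ i, saw (x / Function.update n j m i) := by
    intro x
    have hper : ∀ k : ℕ, ∀ i ∈ Finset.univ.erase j,
        saw ((x + k * Q) / n i) = saw (x / Function.update n j m i) := by
      intro k i hi
      obtain ⟨c, hc⟩ : n i ∣ A := Finset.dvd_prod_of_mem n hi
      have hi0 : (n i : ℝ) ≠ 0 := by exact_mod_cast (hn i).ne'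
      rw [hne i hi, ← saw_add_int (x / n i) (k * m * c : ℕ)]
      congr 1
      rw [hQ, hc]
      push_cast
      field_simp
    have hfac : ∀ k ∈ Finset.range p, ∏ i, saw ((x + k * Q) / n i) =
        saw (x / (p * m) + (k * A : ℝ) / p) *
          ∏ i ∈ Finset.univ.erase j, saw (x / Function.update n j m i) := by
      intro k _
      rw [hprod, Finset.prod_congr rfl (hper k)]
      congr 2
      rw [hm, hQ]
      push_cast
      field_simp
    rw [Finset.sum_congr rfl hfac, ← Finset.sum_mul, sum_range_saw_add_mul_div hp hco, hprod,
      Function.update_self]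
    congr 2
    field_simp
  have hint : ∫ x in (0 : ℝ)..(p * Q), ∏ i, saw (x / n i) =
      ∫ x in (0 : ℝ)..Q, ∏ i, saw (x / Function.update n j m i) := by
    have hsplit := intervalIntegral.sum_integral_adjacent_intervals (μ := volume)
      (f := fun x : ℝ => ∏ i, saw (x / n i)) (a := fun k : ℕ => (k : ℝ) * Q) (n := p)
      fun k _ => by simpa using intervalIntegrable_prod_saw n 0 (k * Q) ((k + 1 : ℕ) * Q)
    simp only [Nat.cast_zero, zero_mul] at hsplit
    rw [← hsplit, ← intervalIntegral.integral_congr fun x _ => hpt x,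
      intervalIntegral.integral_finsetSum fun k _ => intervalIntegrable_prod_saw n _ _ _]
    refine Finset.sum_congr rfl fun k _ => ?_
    rw [intervalIntegral.integral_comp_add_right (fun x : ℝ => ∏ i, saw (x / n i))]
    congr 1 <;> push_cast <;> ring
  unfold Bcorr
  rw [hN, hN', hint, one_div, one_div, mul_inv, mul_assoc]

/-- Proposition 3.1, part 3: bound via the squarefree part of the product. -/
theorem Bcorr_squarefree_bound {l : ℕ} (n : Fin l → ℕ) (hn : ∀ j, 0 < n j)
    (r s : ℕ) (hrs : ∏ j, n j = r * s) (hco : Nat.Coprime r s)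
    (hr : Squarefree r) (hs : ∀ p : ℕ, p.Prime → p ∣ s → p ^ 2 ∣ s) :
    |Bcorr n| ≤ ((2 : ℝ) ^ l)⁻¹ * (r : ℝ)⁻¹ := by
  clear hs
  induction r using induction_on_primes generalizing n with
  | zero => exact absurd hr not_squarefree_zero
  | one => simpa using abs_Bcorr_le n
  | prime_mul p a hp ih =>
    obtain ⟨j, -, m, hm⟩ : ∃ j ∈ Finset.univ, p ∣ n j :=
      (hp.prime.dvd_finsetProd_iff _).1 (hrs ▸ Dvd.intro _ (mul_assoc p a s).symm)
    have hm0 : 0 < m := Nat.pos_of_mul_pos_left (hm ▸ hn j)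
    have hsplit : m * ∏ i ∈ Finset.univ.erase j, n i = a * s := by
      apply Nat.eq_of_mul_eq_mul_left hp.pos
      rw [← mul_assoc, ← hm, Finset.mul_prod_erase _ n (Finset.mem_univ j), hrs, mul_assoc]
    have hpas : Nat.Coprime (a * s) p :=
      ((Nat.squarefree_mul_iff.1 hr).1.symm).mul_left hco.coprime_mul_right.symm
    have hprod : ∏ i, Function.update n j m i = a * s := by
      rw [Finset.prod_update_of_mem (Finset.mem_univ j), ← hsplit, Finset.sdiff_singleton_eq_erase]
    have hpos : ∀ i, 0 < Function.update n j m i := by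
      intro i
      rcases eq_or_ne i j with rfl | h
      · rwa [Function.update_self]
      · rw [Function.update_of_ne h]
        exact hn i
    have hB := ih _ hpos hprod hco.coprime_mul_left (Nat.squarefree_mul_iff.1 hr).2.2
    rw [Bcorr_eq_inv_mul_Bcorr_update n hn j hp.pos hm
        (Nat.Coprime.coprime_dvd_left (hsplit ▸ Dvd.intro_left m rfl) hpas),
      abs_mul, abs_of_nonneg (by positivity), Nat.cast_mul, mul_inv, mul_left_comm]
    exact mul_le_mul_of_nonneg_left hB (by positivity)
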